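/- In the polynomial ring ℂ[∂_1,…,∂_6], the ideal I = ⟨∂_4∂_5, ∂_3∂_5, ∂_2∂_5, ∂_1∂_5, ∂_3∂_4∂_6, ∂_2∂_4∂_6, ∂_1∂_3∂_4, ∂_1∂_2∂_4, ∂_5³ − ∂_6∂_5, ∂_2∂_3²∂_4 − ∂_3∂_4², ∂_1²∂_4³ − ∂_4∂_6, ∂_1²∂_2²∂_3³ − ∂_3∂_6, ∂_1²∂_2³∂_3² − ∂_2∂_6⟩ equals the intersection I_1 ∩ I_2 ∩ I_3 ∩ I_4 ∩ I_5 ∩ I_6, where I_1 = ⟨∂_1²∂_2²∂_3² − ∂_6, ∂_4, ∂_5⟩, I_2 = ⟨∂_2∂_3 − ∂_4, ∂_1, ∂_5, ∂_6⟩, I_3 = ⟨∂_1, ∂_3, ∂_5, ∂_6⟩, I_4 = ⟨∂_5² − ∂_6, ∂_1, ∂_2, ∂_3, ∂_4⟩, I_5 = ⟨∂_1²∂_4² − ∂_6, ∂_2, ∂_3, ∂_5⟩ and I_6 = ⟨∂_2, ∂_3, ∂_4, ∂_5⟩; moreover each I_i is a prime ideal. -/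

import Mathlib

open MvPolynomial

noncomputable section

abbrev R6 : Type := MvPolynomial (Fin 6) ℂ

def d1 : R6 := X 0
def d2 : R6 := X 1
def d3 : R6 := X 2
def d4 : R6 := X 3
def d5 : R6 := X 4
def d6 : R6 := X 5

theorem span_eq_ker (S : Set R6) (φ : R6 →ₐ[ℂ] R6) (h0 : ∀ g ∈ S, φ g = 0)
    (h1 : ∀ i, φ (X i) - X i ∈ Ideal.span S) : Ideal.span S = RingHom.ker φ := by
  apply le_antisymm
  · rw [Ideal.span_le]
    intro g hg
    exact h0 g hg
  · intro f hf
    have h2 : (Ideal.Quotient.mkₐ ℂ (Ideal.span S)).comp φ = Ideal.Quotient.mkₐ ℂ (Ideal.span S) := by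
      apply MvPolynomial.algHom_ext
      intro i
      simp only [AlgHom.comp_apply, Ideal.Quotient.mkₐ_eq_mk]
      exact Ideal.Quotient.eq.2 (h1 i)
    have h3 := DFunLike.congr_fun h2 f
    have hf' : φ f = 0 := hf
    simp only [AlgHom.comp_apply, Ideal.Quotient.mkₐ_eq_mk, hf', map_zero] at h3
    exact Ideal.Quotient.eq_zero_iff_mem.1 h3.symm

theorem ker_prime (φ : R6 →ₐ[ℂ] R6) : (RingHom.ker φ).IsPrime := RingHom.ker_isPrime φ

theorem mem_span_two {a b f : R6} : f ∈ Ideal.span ({a, b} : Set R6) ↔ ∃ x y, f = x * a + y * b := by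
  rw [Ideal.mem_span_pair]
  constructor <;> rintro ⟨x, y, h⟩ <;> exact ⟨x, y, h.symm⟩

theorem mem_span_three {a b c f : R6} :
    f ∈ Ideal.span ({a, b, c} : Set R6) ↔ ∃ x y z, f = x * a + y * b + z * c := by
  rw [Ideal.mem_span_insert]
  constructor
  · rintro ⟨x, z, hz, rfl⟩
    obtain ⟨y, z, rfl⟩ := mem_span_two.1 hz
    exact ⟨x, y, z, by ring⟩
  · rintro ⟨x, y, z, rfl⟩
    exact ⟨x, _, mem_span_two.2 ⟨y, z, rfl⟩, by ring⟩

theorem mem_span_four {a b c d f : R6} :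
    f ∈ Ideal.span ({a, b, c, d} : Set R6) ↔ ∃ x y z w, f = x * a + y * b + z * c + w * d := by
  rw [Ideal.mem_span_insert]
  constructor
  · rintro ⟨x, z, hz, rfl⟩
    obtain ⟨y, z, w, rfl⟩ := mem_span_three.1 hz
    exact ⟨x, y, z, w, by ring⟩
  · rintro ⟨x, y, z, w, rfl⟩
    exact ⟨x, _, mem_span_three.2 ⟨y, z, w, rfl⟩, by ring⟩

theorem mem_span_five {a b c d e f : R6} :
    f ∈ Ideal.span ({a, b, c, d, e} : Set R6) ↔
      ∃ x y z w v, f = x * a + y * b + z * c + w * d + v * e := by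
  rw [Ideal.mem_span_insert]
  constructor
  · rintro ⟨x, z, hz, rfl⟩
    obtain ⟨y, z, w, v, rfl⟩ := mem_span_four.1 hz
    exact ⟨x, y, z, w, v, by ring⟩
  · rintro ⟨x, y, z, w, v, rfl⟩
    exact ⟨x, _, mem_span_four.2 ⟨y, z, w, v, rfl⟩, by ring⟩

def ph1 : R6 →ₐ[ℂ] R6 := aeval ![d1, d2, d3, 0, 0, d1 ^ 2 * d2 ^ 2 * d3 ^ 2]

theorem span_ker1 : Ideal.span ({d1 ^ 2 * d2 ^ 2 * d3 ^ 2 - d6, d4, d5} : Set R6) = RingHom.ker ph1 := by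
  apply span_eq_ker
  · intro g hg
    simp only [Set.mem_insert_iff, Set.mem_singleton_iff] at hg
    rcases hg with rfl | rfl | rfl <;> simp [ph1, d1, d2, d3, d4, d5, d6]
  · intro i
    rw [mem_span_three]
    fin_cases i
    · exact ⟨0, 0, 0, by simp [ph1, d1, d2, d3, d4, d5, d6]⟩
    · exact ⟨0, 0, 0, by simp [ph1, d1, d2, d3, d4, d5, d6]⟩
    · exact ⟨0, 0, 0, by simp [ph1, d1, d2, d3, d4, d5, d6]⟩
    · exact ⟨0, -1, 0, by simp [ph1, d1, d2, d3, d4, d5, d6]⟩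
    · exact ⟨0, 0, -1, by simp [ph1, d1, d2, d3, d4, d5, d6]⟩
    · exact ⟨1, 0, 0, by simp [ph1, d1, d2, d3, d4, d5, d6]⟩

theorem prime1 : (Ideal.span ({d1 ^ 2 * d2 ^ 2 * d3 ^ 2 - d6, d4, d5} : Set R6)).IsPrime := by
  rw [span_ker1]; exact ker_prime _

def ph2 : R6 →ₐ[ℂ] R6 := aeval ![0, d2, d3, d2 * d3, 0, 0]

theorem span_ker2 : Ideal.span ({d2 * d3 - d4, d1, d5, d6} : Set R6) = RingHom.ker ph2 := by
  apply span_eq_ker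
  · intro g hg
    simp only [Set.mem_insert_iff, Set.mem_singleton_iff] at hg
    rcases hg with rfl | rfl | rfl | rfl <;> simp [ph2, d1, d2, d3, d4, d5, d6]
  · intro i
    rw [mem_span_four]
    fin_cases i
    · exact ⟨0, -1, 0, 0, by simp [ph2, d1, d2, d3, d4, d5, d6]⟩
    · exact ⟨0, 0, 0, 0, by simp [ph2, d1, d2, d3, d4, d5, d6]⟩
    · exact ⟨0, 0, 0, 0, by simp [ph2, d1, d2, d3, d4, d5, d6]⟩
    · exact ⟨1, 0, 0, 0, by simp [ph2, d1, d2, d3, d4, d5, d6]⟩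
    · exact ⟨0, 0, -1, 0, by simp [ph2, d1, d2, d3, d4, d5, d6]⟩
    · exact ⟨0, 0, 0, -1, by simp [ph2, d1, d2, d3, d4, d5, d6]⟩

theorem prime2 : (Ideal.span ({d2 * d3 - d4, d1, d5, d6} : Set R6)).IsPrime := by
  rw [span_ker2]; exact ker_prime _

def ph3 : R6 →ₐ[ℂ] R6 := aeval ![0, d2, 0, d4, 0, 0]

theorem span_ker3 : Ideal.span ({d1, d3, d5, d6} : Set R6) = RingHom.ker ph3 := by
  apply span_eq_ker
  · intro g hg
    simp only [Set.mem_insert_iff, Set.mem_singleton_iff] at hg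
    rcases hg with rfl | rfl | rfl | rfl <;> simp [ph3, d1, d2, d3, d4, d5, d6]
  · intro i
    rw [mem_span_four]
    fin_cases i
    · exact ⟨-1, 0, 0, 0, by simp [ph3, d1, d2, d3, d4, d5, d6]⟩
    · exact ⟨0, 0, 0, 0, by simp [ph3, d1, d2, d3, d4, d5, d6]⟩
    · exact ⟨0, -1, 0, 0, by simp [ph3, d1, d2, d3, d4, d5, d6]⟩
    · exact ⟨0, 0, 0, 0, by simp [ph3, d1, d2, d3, d4, d5, d6]⟩
    · exact ⟨0, 0, -1, 0, by simp [ph3, d1, d2, d3, d4, d5, d6]⟩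
    · exact ⟨0, 0, 0, -1, by simp [ph3, d1, d2, d3, d4, d5, d6]⟩

theorem prime3 : (Ideal.span ({d1, d3, d5, d6} : Set R6)).IsPrime := by
  rw [span_ker3]; exact ker_prime _

def ph4 : R6 →ₐ[ℂ] R6 := aeval ![0, 0, 0, 0, d5, d5 ^ 2]

theorem span_ker4 : Ideal.span ({d5 ^ 2 - d6, d1, d2, d3, d4} : Set R6) = RingHom.ker ph4 := by
  apply span_eq_ker
  · intro g hg
    simp only [Set.mem_insert_iff, Set.mem_singleton_iff] at hg
    rcases hg with rfl | rfl | rfl | rfl | rfl <;> simp [ph4, d1, d2, d3, d4, d5, d6]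
  · intro i
    rw [mem_span_five]
    fin_cases i
    · exact ⟨0, -1, 0, 0, 0, by simp [ph4, d1, d2, d3, d4, d5, d6]⟩
    · exact ⟨0, 0, -1, 0, 0, by simp [ph4, d1, d2, d3, d4, d5, d6]⟩
    · exact ⟨0, 0, 0, -1, 0, by simp [ph4, d1, d2, d3, d4, d5, d6]⟩
    · exact ⟨0, 0, 0, 0, -1, by simp [ph4, d1, d2, d3, d4, d5, d6]⟩
    · exact ⟨0, 0, 0, 0, 0, by simp [ph4, d1, d2, d3, d4, d5, d6]⟩
    · exact ⟨1, 0, 0, 0, 0, by simp [ph4, d1, d2, d3, d4, d5, d6]⟩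

theorem prime4 : (Ideal.span ({d5 ^ 2 - d6, d1, d2, d3, d4} : Set R6)).IsPrime := by
  rw [span_ker4]; exact ker_prime _

def ph5 : R6 →ₐ[ℂ] R6 := aeval ![d1, 0, 0, d4, 0, d1 ^ 2 * d4 ^ 2]

theorem span_ker5 : Ideal.span ({d1 ^ 2 * d4 ^ 2 - d6, d2, d3, d5} : Set R6) = RingHom.ker ph5 := by
  apply span_eq_ker
  · intro g hg
    simp only [Set.mem_insert_iff, Set.mem_singleton_iff] at hg
    rcases hg with rfl | rfl | rfl | rfl <;> simp [ph5, d1, d2, d3, d4, d5, d6]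
  · intro i
    rw [mem_span_four]
    fin_cases i
    · exact ⟨0, 0, 0, 0, by simp [ph5, d1, d2, d3, d4, d5, d6]⟩
    · exact ⟨0, -1, 0, 0, by simp [ph5, d1, d2, d3, d4, d5, d6]⟩
    · exact ⟨0, 0, -1, 0, by simp [ph5, d1, d2, d3, d4, d5, d6]⟩
    · exact ⟨0, 0, 0, 0, by simp [ph5, d1, d2, d3, d4, d5, d6]⟩
    · exact ⟨0, 0, 0, -1, by simp [ph5, d1, d2, d3, d4, d5, d6]⟩
    · exact ⟨1, 0, 0, 0, by simp [ph5, d1, d2, d3, d4, d5, d6]⟩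

theorem prime5 : (Ideal.span ({d1 ^ 2 * d4 ^ 2 - d6, d2, d3, d5} : Set R6)).IsPrime := by
  rw [span_ker5]; exact ker_prime _

def ph6 : R6 →ₐ[ℂ] R6 := aeval ![d1, 0, 0, 0, 0, d6]

theorem span_ker6 : Ideal.span ({d2, d3, d4, d5} : Set R6) = RingHom.ker ph6 := by
  apply span_eq_ker
  · intro g hg
    simp only [Set.mem_insert_iff, Set.mem_singleton_iff] at hg
    rcases hg with rfl | rfl | rfl | rfl <;> simp [ph6, d1, d2, d3, d4, d5, d6]
  · intro i
    rw [mem_span_four]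
    fin_cases i
    · exact ⟨0, 0, 0, 0, by simp [ph6, d1, d2, d3, d4, d5, d6]⟩
    · exact ⟨-1, 0, 0, 0, by simp [ph6, d1, d2, d3, d4, d5, d6]⟩
    · exact ⟨0, -1, 0, 0, by simp [ph6, d1, d2, d3, d4, d5, d6]⟩
    · exact ⟨0, 0, -1, 0, by simp [ph6, d1, d2, d3, d4, d5, d6]⟩
    · exact ⟨0, 0, 0, -1, by simp [ph6, d1, d2, d3, d4, d5, d6]⟩
    · exact ⟨0, 0, 0, 0, by simp [ph6, d1, d2, d3, d4, d5, d6]⟩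

theorem prime6 : (Ideal.span ({d2, d3, d4, d5} : Set R6)).IsPrime := by
  rw [span_ker6]; exact ker_prime _

def ph7 : R6 →ₐ[ℂ] R6 := aeval ![d1, 0, d3, 0, 0, 0]

theorem span_ker7 : Ideal.span ({d2, d4, d5, d6} : Set R6) = RingHom.ker ph7 := by
  apply span_eq_ker
  · intro g hg
    simp only [Set.mem_insert_iff, Set.mem_singleton_iff] at hg
    rcases hg with rfl | rfl | rfl | rfl <;> simp [ph7, d1, d2, d3, d4, d5, d6]
  · intro i
    rw [mem_span_four]
    fin_cases i
    · exact ⟨0, 0, 0, 0, by simp [ph7, d1, d2, d3, d4, d5, d6]⟩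
    · exact ⟨-1, 0, 0, 0, by simp [ph7, d1, d2, d3, d4, d5, d6]⟩
    · exact ⟨0, 0, 0, 0, by simp [ph7, d1, d2, d3, d4, d5, d6]⟩
    · exact ⟨0, -1, 0, 0, by simp [ph7, d1, d2, d3, d4, d5, d6]⟩
    · exact ⟨0, 0, -1, 0, by simp [ph7, d1, d2, d3, d4, d5, d6]⟩
    · exact ⟨0, 0, 0, -1, by simp [ph7, d1, d2, d3, d4, d5, d6]⟩

theorem prime7 : (Ideal.span ({d2, d4, d5, d6} : Set R6)).IsPrime := by
  rw [span_ker7]; exact ker_prime _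

theorem nm5 : d4 ∉ Ideal.span ({d1 ^ 2 * d4 ^ 2 - d6, d2, d3, d5} : Set R6) := by
  rw [span_ker5, RingHom.mem_ker]; simp [ph5, d1, d2, d3, d4, d5, d6]

theorem nm7 : d3 ∉ Ideal.span ({d2, d4, d5, d6} : Set R6) := by
  rw [span_ker7, RingHom.mem_ker]; simp [ph7, d1, d2, d3, d4, d5, d6]

theorem nm1 : d2 ∉ Ideal.span ({d1 ^ 2 * d2 ^ 2 * d3 ^ 2 - d6, d4, d5} : Set R6) := by
  rw [span_ker1, RingHom.mem_ker]; simp [ph1, d1, d2, d3, d4, d5, d6]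

theorem nm4 : d5 ∉ Ideal.span ({d5 ^ 2 - d6, d1, d2, d3, d4} : Set R6) := by
  rw [span_ker4, RingHom.mem_ker]; simp [ph4, d1, d2, d3, d4, d5, d6]

theorem nm3 : d2 * d4 ∉ Ideal.span ({d1, d3, d5, d6} : Set R6) := by
  rw [span_ker3, RingHom.mem_ker]; simp [ph3, d1, d2, d3, d4, d5, d6]

theorem nm2 : d3 * d4 ∉ Ideal.span ({d2 * d3 - d4, d1, d5, d6} : Set R6) := by
  rw [span_ker2, RingHom.mem_ker]; simp [ph2, d1, d2, d3, d4, d5, d6]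

/-- The ideal of Example 4.10 equals the intersection of the six prime ideals
`I₁ = ⟨∂₁²∂₂²∂₃² − ∂₆, ∂₄, ∂₅⟩`, `I₂ = ⟨∂₂∂₃ − ∂₄, ∂₁, ∂₅, ∂₆⟩`,
`I₃ = ⟨∂₁, ∂₃, ∂₅, ∂₆⟩`, `I₄ = ⟨∂₅² − ∂₆, ∂₁, ∂₂, ∂₃, ∂₄⟩`,
`I₅ = ⟨∂₁²∂₄² − ∂₆, ∂₂, ∂₃, ∂₅⟩` and `I₆ = ⟨∂₂, ∂₃, ∂₄, ∂₅⟩`. -/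
theorem example_prime_decomposition_six_vars :
    Ideal.span ({d4 * d5, d3 * d5, d2 * d5, d1 * d5,
        d3 * d4 * d6, d2 * d4 * d6, d1 * d3 * d4, d1 * d2 * d4,
        d5 ^ 3 - d6 * d5, d2 * d3 ^ 2 * d4 - d3 * d4 ^ 2,
        d1 ^ 2 * d4 ^ 3 - d4 * d6, d1 ^ 2 * d2 ^ 2 * d3 ^ 3 - d3 * d6,
        d1 ^ 2 * d2 ^ 3 * d3 ^ 2 - d2 * d6} : Set R6) =
      Ideal.span ({d1 ^ 2 * d2 ^ 2 * d3 ^ 2 - d6, d4, d5} : Set R6) ⊓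
      Ideal.span ({d2 * d3 - d4, d1, d5, d6} : Set R6) ⊓
      Ideal.span ({d1, d3, d5, d6} : Set R6) ⊓
      Ideal.span ({d5 ^ 2 - d6, d1, d2, d3, d4} : Set R6) ⊓
      Ideal.span ({d1 ^ 2 * d4 ^ 2 - d6, d2, d3, d5} : Set R6) ⊓
      Ideal.span ({d2, d3, d4, d5} : Set R6) ∧
    (Ideal.span ({d1 ^ 2 * d2 ^ 2 * d3 ^ 2 - d6, d4, d5} : Set R6)).IsPrime ∧
    (Ideal.span ({d2 * d3 - d4, d1, d5, d6} : Set R6)).IsPrime ∧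
    (Ideal.span ({d1, d3, d5, d6} : Set R6)).IsPrime ∧
    (Ideal.span ({d5 ^ 2 - d6, d1, d2, d3, d4} : Set R6)).IsPrime ∧
    (Ideal.span ({d1 ^ 2 * d4 ^ 2 - d6, d2, d3, d5} : Set R6)).IsPrime ∧
    (Ideal.span ({d2, d3, d4, d5} : Set R6)).IsPrime := by
  refine ⟨?_, prime1, prime2, prime3, prime4, prime5, prime6⟩
  apply le_antisymm
  · rw [Ideal.span_le]
    intro g hg
    simp only [SetLike.mem_coe, Submodule.mem_inf]
    rw [span_ker1, span_ker2, span_ker3, span_ker4, span_ker5, span_ker6]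
    simp only [RingHom.mem_ker]
    simp only [Set.mem_insert_iff, Set.mem_singleton_iff] at hg
    rcases hg with rfl | rfl | rfl | rfl | rfl | rfl | rfl | rfl | rfl | rfl | rfl | rfl | rfl <;>
      simp [ph1, ph2, ph3, ph4, ph5, ph6, d1, d2, d3, d4, d5, d6] <;> ring_nf <;> simp
  · intro f hf
    simp only [Submodule.mem_inf] at hf
    obtain ⟨⟨⟨⟨⟨h1, h2⟩, h3⟩, h4⟩, h5⟩, h6⟩ := hf
    obtain ⟨a, b, c, e, hf⟩ := mem_span_four.1 h6
    -- I5
    have k5 : d4 * c ∈ Ideal.span ({d1 ^ 2 * d4 ^ 2 - d6, d2, d3, d5} : Set R6) := by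
      obtain ⟨x, y, z, w, hx⟩ := mem_span_four.1 h5
      exact mem_span_four.2 ⟨x, y - a, z - b, w - e, by linear_combination hx - hf⟩
    obtain ⟨c0, c1, c2, c3, hc⟩ := mem_span_four.1 ((prime5.mem_or_mem k5).resolve_left nm5)
    -- I1
    have k1 : d2 * (a + d4 * c1) + d3 * (b + d4 * c2) ∈
        Ideal.span ({d1 ^ 2 * d2 ^ 2 * d3 ^ 2 - d6, d4, d5} : Set R6) := by
      obtain ⟨x, y, z, hx⟩ := mem_span_three.1 h1
      exact mem_span_three.2 ⟨x, y - (d1 ^ 2 * d4 ^ 2 - d6) * c0, z - e - d4 * c3,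
        by linear_combination hx - hf - d4 * hc⟩
    have k7 : d3 * (b + d4 * c2) ∈ Ideal.span ({d2, d4, d5, d6} : Set R6) := by
      obtain ⟨x, y, z, hx⟩ := mem_span_three.1 k1
      exact mem_span_four.2 ⟨x * d1 ^ 2 * d2 * d3 ^ 2 - (a + d4 * c1), y, z, -x,
        by linear_combination hx⟩
    obtain ⟨t, b1, b2, b3, hb⟩ := mem_span_four.1 ((prime7.mem_or_mem k7).resolve_left nm7)
    -- `b + d4 c2 = d2 t' + (element of I1)`
    have k1' : d2 * (a + d4 * c1 + d3 * (t + b3 * d1 ^ 2 * d2 * d3 ^ 2)) ∈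
        Ideal.span ({d1 ^ 2 * d2 ^ 2 * d3 ^ 2 - d6, d4, d5} : Set R6) := by
      obtain ⟨x, y, z, hx⟩ := mem_span_three.1 k1
      exact mem_span_three.2 ⟨x + d3 * b3, y - d3 * b1, z - d3 * b2,
        by linear_combination hx - d3 * hb⟩
    obtain ⟨a0, a1, a2, ha⟩ := mem_span_three.1 ((prime1.mem_or_mem k1').resolve_left nm1)
    have hf1 : f = (d2 * a0 - d3 * b3) * (d1 ^ 2 * d2 ^ 2 * d3 ^ 2 - d6) + d2 * d4 * a1
        + d3 * d4 * b1 + d5 * (e + d4 * c3 + d2 * a2 + d3 * b2)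
        + d4 * (d1 ^ 2 * d4 ^ 2 - d6) * c0 := by
      linear_combination hf + d4 * hc + d2 * ha + d3 * hb
    generalize e + d4 * c3 + d2 * a2 + d3 * b2 = e' at hf1
    -- I4
    have k4 : d5 * e' ∈ Ideal.span ({d5 ^ 2 - d6, d1, d2, d3, d4} : Set R6) := by
      obtain ⟨x, y, z, w, v, hx⟩ := mem_span_five.1 h4
      exact mem_span_five.2 ⟨x, y, z - a0 * (d1 ^ 2 * d2 ^ 2 * d3 ^ 2 - d6) - d4 * a1,
        w + b3 * (d1 ^ 2 * d2 ^ 2 * d3 ^ 2 - d6) - d4 * b1,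
        v - (d1 ^ 2 * d4 ^ 2 - d6) * c0, by linear_combination hx - hf1⟩
    obtain ⟨e0, e1, e2, e3, e4, he⟩ := mem_span_five.1 ((prime4.mem_or_mem k4).resolve_left nm4)
    -- I3
    have k3 : d2 * d4 * a1 ∈ Ideal.span ({d1, d3, d5, d6} : Set R6) := by
      obtain ⟨x, y, z, w, hx⟩ := mem_span_four.1 h3
      exact mem_span_four.2 ⟨x - (d2 * a0 - d3 * b3) * (d1 * d2 ^ 2 * d3 ^ 2) - d4 * d1 * d4 ^ 2 * c0,
        y - d4 * b1, z - e', w + (d2 * a0 - d3 * b3) + d4 * c0, by linear_combination hx - hf1⟩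
    obtain ⟨s0, s1, s2, s3, hs⟩ := mem_span_four.1 ((prime3.mem_or_mem k3).resolve_left nm3)
    -- I2
    have k2 : d3 * d4 * (b1 + d2 * s1) ∈ Ideal.span ({d2 * d3 - d4, d1, d5, d6} : Set R6) := by
      obtain ⟨x, y, z, w, hx⟩ := mem_span_four.1 h2
      exact mem_span_four.2 ⟨x,
        y - (d2 * a0 - d3 * b3) * (d1 * d2 ^ 2 * d3 ^ 2) - d4 * d1 * d4 ^ 2 * c0 - d2 * d4 * s0,
        z - e' - d2 * d4 * s2, w + (d2 * a0 - d3 * b3) + d4 * c0 - d2 * d4 * s3,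
        by linear_combination hx - hf1 - d2 * d4 * hs⟩
    obtain ⟨r0, r1, r2, r3, hr⟩ := mem_span_four.1 ((prime2.mem_or_mem k2).resolve_left nm2)
    have hfin : f = a0 * (d1 ^ 2 * d2 ^ 3 * d3 ^ 2 - d2 * d6) - b3 * (d1 ^ 2 * d2 ^ 2 * d3 ^ 3 - d3 * d6) + (d2 * s2 + d3 * r2 + e4) * (d4 * d5) + e3 * (d3 * d5) + e2 * (d2 * d5) + e1 * (d1 * d5)
        + r3 * (d3 * d4 * d6) + s3 * (d2 * d4 * d6) + r1 * (d1 * d3 * d4) + s0 * (d1 * d2 * d4) + e0 * (d5 ^ 3 - d6 * d5) + r0 * (d2 * d3 ^ 2 * d4 - d3 * d4 ^ 2) + c0 * (d1 ^ 2 * d4 ^ 3 - d4 * d6) := by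
      linear_combination hf1 + d5 * he + d2 * d4 * hs + d3 * d4 * hr
    rw [hfin]
    refine Ideal.add_mem _ (Ideal.add_mem _ (Ideal.add_mem _ (Ideal.add_mem _ (Ideal.add_mem _ (Ideal.add_mem _ (Ideal.add_mem _ (Ideal.add_mem _ (Ideal.add_mem _ (Ideal.add_mem _ (Ideal.add_mem _ (Ideal.sub_mem _ ?_ ?_) ?_) ?_) ?_) ?_) ?_) ?_) ?_) ?_) ?_) ?_) ?_ <;>
      exact Ideal.mul_mem_left _ _ (Ideal.subset_span (by
        simp only [Set.mem_insert_iff, Set.mem_singleton_iff, true_or, or_true]))
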